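/- For every prime p, the group G_p is not operator-norm-to-Hilbert–Schmidt stable: there exist a sequence of positive integers (n_k) and functions π_k : G_p → U(n_k) such that lim_k ‖π_k(gh) − π_k(g)π_k(h)‖_∞ = 0 for all g, h ∈ G_p (operator norm), but there is no sequence of group homomorphisms σ_k : G_p → U(n_k) with lim_k ‖π_k(g) − σ_k(g)‖₂ = 0 for all g ∈ G_p (normalized Hilbert–Schmidt norm). -/

import Mathlib

open Filter Topology Matrix

/-- `ℤ[1/p]` as an additive subgroup of `ℚ`: rationals of the form `k / p^n`. -/
def Zp (p : ℕ) : AddSubgroup ℚ where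
  carrier := {q : ℚ | ∃ (k : ℤ) (n : ℕ), q * (p : ℚ) ^ n = (k : ℚ)}
  zero_mem' := ⟨0, 0, by norm_num⟩
  add_mem' := by
    rintro a b ⟨k1, n1, h1⟩ ⟨k2, n2, h2⟩
    refine ⟨k1 * (p : ℤ) ^ n2 + k2 * (p : ℤ) ^ n1, n1 + n2, ?_⟩
    push_cast
    calc (a + b) * (p : ℚ) ^ (n1 + n2)
        = a * (p : ℚ) ^ n1 * (p : ℚ) ^ n2 + b * (p : ℚ) ^ n2 * (p : ℚ) ^ n1 := by
          rw [pow_add]; ring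
      _ = (k1 : ℚ) * (p : ℚ) ^ n2 + (k2 : ℚ) * (p : ℚ) ^ n1 := by rw [h1, h2]
  neg_mem' := by
    rintro a ⟨k, n, h⟩
    refine ⟨-k, n, ?_⟩
    push_cast
    rw [neg_mul, h]

lemma one_mem_Zp (p : ℕ) : (1 : ℚ) ∈ Zp p := ⟨1, 0, by norm_num⟩

/-- The group `G_p = ℤ[1/p]² ⋊ ℤ`, realized as triples `(a, b, c)` with the
multiplication `(a₁,b₁,c₁)(a₂,b₂,c₂) = (a₁+a₂+c₁b₂, b₁+b₂, c₁+c₂)`. -/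
abbrev Gp (p : ℕ) : Type := Zp p × Zp p × ℤ

instance Gp.instGroup (p : ℕ) : Group (Gp p) where
  mul x y := ⟨x.1 + y.1 + x.2.2 • y.2.1, x.2.1 + y.2.1, x.2.2 + y.2.2⟩
  one := ⟨0, 0, 0⟩
  inv x := ⟨-x.1 + x.2.2 • x.2.1, -x.2.1, -x.2.2⟩
  mul_assoc x y z := by
    refine Prod.ext ?_ (Prod.ext ?_ ?_)
    · show x.1 + y.1 + x.2.2 • y.2.1 + z.1 + (x.2.2 + y.2.2) • z.2.1 =
        x.1 + (y.1 + z.1 + y.2.2 • z.2.1) + x.2.2 • (y.2.1 + z.2.1)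
      rw [add_smul, smul_add]; abel
    · show x.2.1 + y.2.1 + z.2.1 = x.2.1 + (y.2.1 + z.2.1)
      rw [add_assoc]
    · show x.2.2 + y.2.2 + z.2.2 = x.2.2 + (y.2.2 + z.2.2)
      rw [add_assoc]
  one_mul x := by
    refine Prod.ext ?_ (Prod.ext ?_ ?_)
    · show 0 + x.1 + (0 : ℤ) • x.2.1 = x.1
      simp
    · show 0 + x.2.1 = x.2.1
      simp
    · show 0 + x.2.2 = x.2.2
      simp
  mul_one x := by
    refine Prod.ext ?_ (Prod.ext ?_ ?_)
    · show x.1 + 0 + x.2.2 • (0 : Zp p) = x.1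
      simp
    · show x.2.1 + 0 = x.2.1
      simp
    · show x.2.2 + 0 = x.2.2
      simp
  inv_mul_cancel x := by
    refine Prod.ext ?_ (Prod.ext ?_ ?_)
    · show -x.1 + x.2.2 • x.2.1 + x.1 + (-x.2.2) • x.2.1 = 0
      rw [neg_smul]; abel
    · show -x.2.1 + x.2.1 = 0
      simp
    · show -x.2.2 + x.2.2 = 0
      simp

/-- The normalized Hilbert–Schmidt norm `‖A‖₂ = (Tr_n(A*A))^{1/2}` of an `n × n`
complex matrix, where `Tr_n` is the normalized trace. -/
noncomputable def hsNorm (n : ℕ) (A : Matrix (Fin n) (Fin n) ℂ) : ℝ :=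
  Real.sqrt ((Aᴴ * A).trace.re / n)

/-- The operator norm `‖A‖_∞` of an `n × n` complex matrix, i.e. the `ℓ² → ℓ²`
operator norm. -/
noncomputable def opNorm (n : ℕ) (A : Matrix (Fin n) (Fin n) ℂ) : ℝ :=
  ‖(Matrix.toEuclideanCLM (𝕜 := ℂ) (n := Fin n) A :
      EuclideanSpace ℂ (Fin n) →L[ℂ] EuclideanSpace ℂ (Fin n))‖

/-- The generalized clock-and-shift matrix `e_x ↦ ψ (a + b (x - c)) e_(x - c)`, indexed by
`ZMod N` through `ZMod.finEquiv`. -/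
noncomputable def clockShift (N : ℕ) [NeZero N] (a b c : ZMod N) : Matrix (Fin N) (Fin N) ℂ :=
  Matrix.of fun y x => if ZMod.finEquiv N x = ZMod.finEquiv N y + c then
    ZMod.stdAddChar (a + b * ZMod.finEquiv N y) else 0

lemma clockShift_mul (N : ℕ) [NeZero N] (a b c a' b' c' : ZMod N) :
    clockShift N a b c * clockShift N a' b' c' =
      clockShift N (a + a' + c * b') (b + b') (c + c') := by
  ext y x
  rw [Matrix.mul_apply, Finset.sum_eq_single ((ZMod.finEquiv N).symm (ZMod.finEquiv N y + c))]
  · simp only [clockShift, Matrix.of_apply, RingEquiv.apply_symm_apply, if_true, add_assoc,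
      mul_ite, mul_zero, ← AddChar.map_add_eq_mul]
    congr 2
    ring
  · intro z _ hz
    have : ZMod.finEquiv N z ≠ ZMod.finEquiv N y + c := by
      intro h
      exact hz (by rw [← h, RingEquiv.symm_apply_apply])
    simp [clockShift, this]
  · simp

lemma clockShift_scalar (N : ℕ) [NeZero N] (a : ZMod N) :
    clockShift N a 0 0 = (ZMod.stdAddChar a : ℂ) • (1 : Matrix (Fin N) (Fin N) ℂ) := by
  ext y x
  simp [clockShift, Matrix.one_apply, eq_comm]

lemma clockShift_zero (N : ℕ) [NeZero N] : clockShift N 0 0 0 = 1 := by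
  simp [clockShift_scalar]

lemma clockShift_conjTranspose (N : ℕ) [NeZero N] (a b c : ZMod N) :
    (clockShift N a b c)ᴴ = clockShift N (-a + c * b) (-b) (-c) := by
  ext y x
  simp only [clockShift, Matrix.conjTranspose_apply, Matrix.of_apply, apply_ite star, star_zero]
  by_cases h : ZMod.finEquiv N y = ZMod.finEquiv N x + c
  · have h' : ZMod.finEquiv N x = ZMod.finEquiv N y + -c := by rw [h]; ring
    rw [if_pos h, if_pos h', h]
    rw [show -a + c * b + -b * (ZMod.finEquiv N x + c) = -(a + b * ZMod.finEquiv N x) by ring,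
      AddChar.map_neg_eq_conj]
    rfl
  · have h' : ¬ ZMod.finEquiv N x = ZMod.finEquiv N y + -c := fun h' => h (by rw [h']; ring)
    rw [if_neg h, if_neg h']

lemma clockShift_mem_unitaryGroup (N : ℕ) [NeZero N] (a b c : ZMod N) :
    clockShift N a b c ∈ Matrix.unitaryGroup (Fin N) ℂ := by
  rw [Matrix.mem_unitaryGroup_iff, Matrix.star_eq_conjTranspose, clockShift_conjTranspose,
    clockShift_mul, ← clockShift_zero]
  congr 1 <;> ring

/-- The numerator of `q` over the denominator `p ^ k`, modulo `p ^ k`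
(only meaningful if `q ∈ p⁻ᵏ ℤ`). -/
def scaledNum (p k : ℕ) (q : ℚ) : ZMod (p ^ k) := ((q * (p : ℚ) ^ k).num : ZMod (p ^ k))

lemma scaledNum_of_eq {p k : ℕ} {q : ℚ} {A : ℤ} (h : q * (p : ℚ) ^ k = A) :
    scaledNum p k q = A := by
  rw [scaledNum, h, Rat.num_intCast]

lemma eventually_exists_scaled (p : ℕ) (q : Zp p) :
    ∀ᶠ k in atTop, ∃ A : ℤ, (q : ℚ) * (p : ℚ) ^ k = A := by
  obtain ⟨A, n, h⟩ := q.2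
  filter_upwards [eventually_ge_atTop n] with k hk
  refine ⟨A * (p : ℤ) ^ (k - n), ?_⟩
  push_cast
  rw [← h, mul_assoc, ← pow_add, Nat.add_sub_cancel' hk]

/-- The finite-level clock-and-shift map on `G_p`; it is multiplicative on elements with
coordinates in `p⁻ᵏ ℤ`. -/
noncomputable def finiteLevel (p k : ℕ) [NeZero (p ^ k)] (g : Gp p) :
    Matrix.unitaryGroup (Fin (p ^ k)) ℂ :=
  ⟨clockShift (p ^ k) (scaledNum p k g.1) (scaledNum p k g.2.1) (g.2.2 : ZMod (p ^ k)),
    clockShift_mem_unitaryGroup _ _ _ _⟩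

lemma Gp.mul_def {p : ℕ} (x y : Gp p) :
    x * y = (x.1 + y.1 + x.2.2 • y.2.1, x.2.1 + y.2.1, x.2.2 + y.2.2) := rfl

lemma Gp.one_def {p : ℕ} : (1 : Gp p) = (0, 0, 0) := rfl

lemma finiteLevel_mul (p : ℕ) [∀ k, NeZero (p ^ k)] (g h : Gp p) :
    ∀ᶠ k in atTop, finiteLevel p k (g * h) = finiteLevel p k g * finiteLevel p k h := by
  filter_upwards [eventually_exists_scaled p g.1, eventually_exists_scaled p g.2.1,
    eventually_exists_scaled p h.1, eventually_exists_scaled p h.2.1]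
    with k ⟨A, hA⟩ ⟨B, hB⟩ ⟨A', hA'⟩ ⟨B', hB'⟩
  apply Subtype.ext
  simp only [finiteLevel, Submonoid.coe_mul, clockShift_mul, Gp.mul_def]
  have h1 : ((g.1 + h.1 + g.2.2 • h.2.1 : Zp p) : ℚ) * (p : ℚ) ^ k
      = ((A + A' + g.2.2 * B' : ℤ) : ℚ) := by
    push_cast
    rw [← hA, ← hA', ← hB', zsmul_eq_mul]
    ring
  have h2 : ((g.2.1 + h.2.1 : Zp p) : ℚ) * (p : ℚ) ^ k = ((B + B' : ℤ) : ℚ) := by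
    push_cast
    rw [← hB, ← hB']
    ring
  rw [scaledNum_of_eq h1, scaledNum_of_eq h2, scaledNum_of_eq hA, scaledNum_of_eq hA',
    scaledNum_of_eq hB, scaledNum_of_eq hB']
  push_cast
  rfl

/-- `1 / p` as an element of `ℤ[1/p]`. -/
def invZp (p : ℕ) (hp : p ≠ 0) : Zp p :=
  ⟨1 / p, 1, 1, by field_simp; simp⟩

/-- The element `1` of `ℤ[1/p]`. -/
def oneZp (p : ℕ) : Zp p := ⟨1, one_mem_Zp p⟩

lemma finiteLevel_one (p k : ℕ) [NeZero (p ^ k)] :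
    (finiteLevel p k (0, oneZp p, 0) : Matrix (Fin (p ^ k)) (Fin (p ^ k)) ℂ) = 1 := by
  have h1 : ((oneZp p : Zp p) : ℚ) * (p : ℚ) ^ k = (((p : ℤ) ^ k : ℤ) : ℚ) := by
    simp [oneZp]
  have h0 : ((0 : Zp p) : ℚ) * (p : ℚ) ^ k = ((0 : ℤ) : ℚ) := by simp
  have h2 : (p : ZMod (p ^ k)) ^ k = 0 := by
    rw [← Nat.cast_pow, ZMod.natCast_self]
  simp only [finiteLevel, scaledNum_of_eq h1, scaledNum_of_eq h0]
  push_cast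
  rw [h2, clockShift_zero]

lemma finiteLevel_inv (p k : ℕ) (hp : p ≠ 0) [NeZero (p ^ k)] (hk : 1 ≤ k) :
    (finiteLevel p k (invZp p hp, 0, 0) : Matrix (Fin (p ^ k)) (Fin (p ^ k)) ℂ)
      = Complex.exp (2 * Real.pi * Complex.I / p) • 1 := by
  obtain ⟨k, rfl⟩ := Nat.exists_eq_add_of_le' hk
  have hp' : (p : ℚ) ≠ 0 := by exact_mod_cast hp
  have hpc : (p : ℂ) ≠ 0 := by exact_mod_cast hp
  have h1 : ((invZp p hp : Zp p) : ℚ) * (p : ℚ) ^ (k + 1) = (((p : ℤ) ^ k : ℤ) : ℚ) := by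
    simp only [invZp]
    push_cast
    field_simp
    ring
  have h0 : ((0 : Zp p) : ℚ) * (p : ℚ) ^ (k + 1) = ((0 : ℤ) : ℚ) := by simp
  simp only [finiteLevel, scaledNum_of_eq h1, scaledNum_of_eq h0]
  rw [Int.cast_zero, clockShift_scalar, ZMod.stdAddChar_coe]
  congr 2
  push_cast
  field_simp
  ring

lemma eigenvalue_pow_finrank_eq_one {V : Type*} [AddCommGroup V] [Module ℂ V]
    [FiniteDimensional ℂ V] {x y z : Module.End ℂ V} (hx : Function.Injective x)
    (hy : Function.Injective y) (hxy : x * y = z * (y * x)) (hzx : Commute z x)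
    (hzy : Commute z y) (η : ℂ) :
    η ^ Module.finrank ℂ (Module.End.eigenspace z η) = 1 := by
  set E := Module.End.eigenspace z η
  have inv : ∀ f : Module.End ℂ V, Commute z f → ∀ v ∈ E, f v ∈ E := by
    intro f hf v hv
    rw [Module.End.mem_eigenspace_iff] at hv ⊢
    rw [← Module.End.mul_apply, hf.eq, Module.End.mul_apply, hv, map_smul]
  have det_ne : ∀ (f : Module.End ℂ V) (hf : Commute z f), Function.Injective f →
      LinearMap.det (f.restrict (inv f hf)) ≠ 0 := by
    intro f hf hinj h
    have h' := LinearMap.bot_lt_ker_of_det_eq_zero h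
    refine h'.ne' (LinearMap.ker_eq_bot.mpr fun a b hab => Subtype.ext (hinj ?_))
    exact congrArg Subtype.val hab
  have key : x.restrict (inv x hzx) * y.restrict (inv y hzy)
      = η • (y.restrict (inv y hzy) * x.restrict (inv x hzx)) := by
    ext v
    have h1 := congrArg (fun f : Module.End ℂ V => f v) hxy
    have h2 := inv y hzy _ (inv x hzx v v.2)
    rw [Module.End.mem_eigenspace_iff] at h2
    simpa [Module.End.mul_apply, h2] using h1
  have h := congrArg LinearMap.det key
  rw [LinearMap.det_smul, map_mul, map_mul, mul_comm (LinearMap.det (y.restrict _))] at h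
  exact (mul_right_cancel₀ (mul_ne_zero (det_ne x hzx hx) (det_ne y hzy hy))
    (by rw [one_mul, ← h])).symm

open scoped Matrix.Norms.L2Operator in
lemma matrix_eq_one_of_spectrum_subset {n : ℕ} {A : Matrix (Fin n) (Fin n) ℂ}
    (hA : IsStarNormal A) (h : spectrum ℂ A ⊆ {1}) : A = 1 :=
  CFC.eq_one_of_spectrum_subset_one (R := ℂ) A h hA

lemma commutator_pow_factorial_eq_one {n : ℕ} (x y z : Matrix.unitaryGroup (Fin n) ℂ)
    (hxy : x * y = z * (y * x)) (hzx : Commute z x) (hzy : Commute z y) :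
    z ^ n.factorial = 1 := by
  have inj : ∀ w : Matrix.unitaryGroup (Fin n) ℂ,
      Function.Injective (Matrix.toLinAlgEquiv' (w : Matrix (Fin n) (Fin n) ℂ)) := by
    intro w
    refine Function.LeftInverse.injective
      (g := Matrix.toLinAlgEquiv' ((w⁻¹ : Matrix.unitaryGroup (Fin n) ℂ) :
        Matrix (Fin n) (Fin n) ℂ)) fun v => ?_
    rw [← Module.End.mul_apply, ← map_mul, ← Submonoid.coe_mul, inv_mul_cancel,
      Submonoid.coe_one, map_one, Module.End.one_apply]
  have lift : ∀ {a b : Matrix.unitaryGroup (Fin n) ℂ}, a = b →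
      Matrix.toLinAlgEquiv' (a : Matrix (Fin n) (Fin n) ℂ) = Matrix.toLinAlgEquiv' b.1 :=
    fun h => by rw [h]
  have hxy' := lift hxy
  have hzx' := lift hzx.eq
  have hzy' := lift hzy.eq
  simp only [Submonoid.coe_mul, map_mul] at hxy' hzx' hzy'
  apply Subtype.ext
  apply matrix_eq_one_of_spectrum_subset ⟨?_⟩
  · rw [SubmonoidClass.coe_pow, spectrum.map_pow_of_pos _ n.factorial_pos]
    rintro _ ⟨η, hη, rfl⟩
    rw [← Matrix.spectrum_toLin', ← Module.End.hasEigenvalue_iff_mem_spectrum] at hη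
    have h1 := eigenvalue_pow_finrank_eq_one (inj x) (inj y) hxy' hzx' hzy' η
    set d := Module.finrank ℂ (Module.End.eigenspace (Matrix.toLinAlgEquiv' z.1) η) with hd
    have hd0 : 0 < d := by
      have : Nontrivial (Module.End.eigenspace (Matrix.toLinAlgEquiv' z.1) η) :=
        Submodule.nontrivial_iff_ne_bot.mpr hη
      exact Module.finrank_pos
    have hdn : d ≤ n := by
      simpa using Submodule.finrank_le (Module.End.eigenspace (Matrix.toLinAlgEquiv' z.1) η)
    obtain ⟨c, hc⟩ := Nat.dvd_factorial hd0 hdn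
    simp [hc, pow_mul, h1]
  · have := (z ^ n.factorial).2
    rw [commute_iff_eq, Matrix.mem_unitaryGroup_iff.mp this, Matrix.mem_unitaryGroup_iff'.mp this]

/-- The unnormalized squared Hilbert–Schmidt norm. -/
noncomputable def hsSq {n : ℕ} (A : Matrix (Fin n) (Fin n) ℂ) : ℝ := (Aᴴ * A).trace.re

open scoped ComplexOrder in
lemma hsSq_nonneg {n : ℕ} (A : Matrix (Fin n) (Fin n) ℂ) : 0 ≤ hsSq A :=
  (Complex.nonneg_iff.mp (Matrix.posSemidef_conjTranspose_mul_self A).trace_nonneg).1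

lemma hsNorm_sq {n : ℕ} (A : Matrix (Fin n) (Fin n) ℂ) : hsNorm n A ^ 2 = hsSq A / n :=
  Real.sq_sqrt (div_nonneg (hsSq_nonneg A) n.cast_nonneg)

lemma hsSq_mul_proj_le {n : ℕ} (A P : Matrix (Fin n) (Fin n) ℂ) (hP : Pᴴ = P)
    (hPP : P * P = P) : hsSq (A * P) ≤ hsSq A := by
  have h1 : ((A * P)ᴴ * (A * P)).trace = (Aᴴ * A * P).trace := by
    rw [Matrix.conjTranspose_mul, hP, mul_assoc, Matrix.trace_mul_comm]
    simp only [mul_assoc, hPP]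
  have h2 : ((A * (1 - P))ᴴ * (A * (1 - P))).trace = (Aᴴ * A * (1 - P)).trace := by
    have : (1 - P) * (1 - P) = 1 - P := by
      rw [sub_mul, mul_sub, mul_sub, hPP]; simp
    rw [Matrix.conjTranspose_mul, Matrix.conjTranspose_sub, Matrix.conjTranspose_one, hP,
      mul_assoc, Matrix.trace_mul_comm]
    simp only [mul_assoc, this]
  have h3 := hsSq_nonneg (A * (1 - P))
  rw [hsSq, h2, mul_sub, Matrix.trace_sub, mul_one, Complex.sub_re] at h3
  rw [hsSq, hsSq, h1]
  linarith

lemma trace_re_conjTranspose {n : ℕ} (A : Matrix (Fin n) (Fin n) ℂ) :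
    (Aᴴ).trace.re = A.trace.re := by
  rw [Matrix.trace_conjTranspose]; rfl

/-- The average of the powers of `Y`; if `Y` is unitary with `Y ^ m = 1`, this is the projection
onto the fixed vectors of `Y`. -/
noncomputable def powAverage {n : ℕ} (m : ℕ) (Y : Matrix (Fin n) (Fin n) ℂ) :
    Matrix (Fin n) (Fin n) ℂ :=
  (m : ℂ)⁻¹ • ∑ i ∈ Finset.range m, Y ^ i

lemma mul_powAverage {n m : ℕ} {Y : Matrix (Fin n) (Fin n) ℂ} (h : Y ^ m = 1) :
    Y * powAverage m Y = powAverage m Y := by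
  rw [powAverage, mul_smul_comm, Finset.mul_sum]
  congr 1
  have h1 := Finset.sum_range_succ (fun i => Y ^ i) m
  rw [Finset.sum_range_succ', h, pow_zero] at h1
  simpa [pow_succ'] using add_right_cancel h1

lemma powAverage_mul {n m : ℕ} (hm : m ≠ 0) {A Q : Matrix (Fin n) (Fin n) ℂ}
    (h : A * Q = Q) : powAverage m A * Q = Q := by
  have hi : ∀ i : ℕ, A ^ i * Q = Q := by
    intro i
    induction i with
    | zero => simp
    | succ i ih => rw [pow_succ, mul_assoc, h, ih]
  have hm' : (m : ℂ) ≠ 0 := by exact_mod_cast hm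
  rw [powAverage, smul_mul_assoc, Finset.sum_mul, Finset.sum_congr rfl fun i _ => hi i]
  simp [← Nat.cast_smul_eq_nsmul ℂ, smul_smul, hm']

lemma powAverage_conjTranspose {n m : ℕ} (Y : Matrix (Fin n) (Fin n) ℂ) :
    (powAverage m Y)ᴴ = powAverage m Yᴴ := by
  simp [powAverage, Matrix.conjTranspose_sum, Matrix.conjTranspose_pow,
    Matrix.conjTranspose_smul]

lemma powAverage_isProj {n m : ℕ} (hm : m ≠ 0) {Y : Matrix (Fin n) (Fin n) ℂ}
    (hY : Yᴴ * Y = 1) (h : Y ^ m = 1) :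
    (powAverage m Y)ᴴ = powAverage m Y ∧ powAverage m Y * powAverage m Y = powAverage m Y := by
  refine ⟨?_, powAverage_mul hm (mul_powAverage h)⟩
  have h1 : Yᴴ * powAverage m Y = powAverage m Y := by
    conv_lhs => rw [← mul_powAverage h, ← mul_assoc, hY, one_mul]
  have h2 : (powAverage m Y)ᴴ * powAverage m Y = powAverage m Y := by
    rw [powAverage_conjTranspose]
    exact powAverage_mul hm h1
  conv_lhs => rw [← h2]
  rw [Matrix.conjTranspose_mul, Matrix.conjTranspose_conjTranspose, h2]

/-- If `V` has the same trace against the projection `P` as in total, and `Z` is the identity on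
the range of `P`, then `V` cannot be close to `1` while `Z` is close to `ω ≠ 1`. -/
lemma hsSq_lower_bound {n : ℕ} {V Z P : Matrix (Fin n) (Fin n) ℂ} (ω : ℂ)
    (hV : Vᴴ * V = 1) (hP : Pᴴ = P) (hPP : P * P = P) (hZ : Z * P = P)
    (htr : (V * P).trace = V.trace) :
    2 * n * ‖ω - 1‖ ^ 2 ≤ ‖ω - 1‖ ^ 2 * hsSq (1 - V) + 2 * hsSq (ω • 1 - Z) := by
  have e1 : hsSq (1 - V) = 2 * n - 2 * V.trace.re := by
    have : (1 - V)ᴴ * (1 - V) = 1 + 1 - V - Vᴴ := by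
      rw [Matrix.conjTranspose_sub, Matrix.conjTranspose_one, sub_mul, mul_sub, mul_sub, hV]
      simp only [one_mul, mul_one]; abel
    rw [hsSq, this]
    simp only [Matrix.trace_sub, Matrix.trace_add, Complex.sub_re, Complex.add_re,
      trace_re_conjTranspose, Matrix.trace_one, Fintype.card_fin, Complex.natCast_re]
    ring
  have e2 : 0 ≤ 2 * P.trace.re - 2 * V.trace.re := by
    have : (((1 - V) * P)ᴴ * ((1 - V) * P)).trace
        = P.trace + P.trace - (V * P).trace - ((V * P)ᴴ).trace := by
      have : ((1 - V) * P)ᴴ * ((1 - V) * P) = P * P + P * (Vᴴ * V) * P - P * (V * P)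
          - (V * P)ᴴ * P := by
        simp only [Matrix.conjTranspose_sub, Matrix.conjTranspose_one, Matrix.conjTranspose_mul,
          hP]
        noncomm_ring
      rw [this, hV, mul_one, hPP, Matrix.trace_sub, Matrix.trace_sub, Matrix.trace_add,
        Matrix.trace_mul_comm P (V * P), Matrix.conjTranspose_mul, hP,
        Matrix.trace_mul_comm (P * Vᴴ) P, ← mul_assoc, hPP, mul_assoc, hPP]
    have h0 := hsSq_nonneg ((1 - V) * P)
    rw [hsSq, this] at h0
    simp only [Complex.sub_re, Complex.add_re, trace_re_conjTranspose, htr] at h0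
    linarith
  have e3 : ‖ω - 1‖ ^ 2 * P.trace.re ≤ hsSq (ω • 1 - Z) := by
    refine le_trans (le_of_eq ?_) (hsSq_mul_proj_le (ω • 1 - Z) P hP hPP)
    have : (ω • 1 - Z) * P = (ω - 1) • P := by
      rw [sub_mul, hZ, smul_mul_assoc, one_mul, sub_smul, one_smul]
    rw [this, hsSq, Matrix.conjTranspose_smul, hP, smul_mul_smul_comm, hPP, Matrix.trace_smul,
      smul_eq_mul, Complex.star_def, mul_comm (starRingEnd ℂ _), Complex.mul_conj,
      Complex.re_ofReal_mul, Complex.normSq_eq_norm_sq]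
  rw [e1]
  nlinarith [sq_nonneg ‖ω - 1‖]

lemma Gp.central_pow {p : ℕ} (a : Zp p) (k : ℕ) : ((a, 0, 0) : Gp p) ^ k = (k • a, 0, 0) := by
  induction k with
  | zero => simp [Gp.one_def]
  | succ k ih => simp [pow_succ, ih, Gp.mul_def, succ_nsmul]

lemma exists_pow_nsmul_eq {p : ℕ} (hp : p ≠ 0) (s : ℕ) (a : Zp p) : ∃ b : Zp p, p ^ s • b = a := by
  obtain ⟨a, k, n, h⟩ := a
  have hp' : (p : ℚ) ≠ 0 := by exact_mod_cast hp
  refine ⟨⟨a / (p : ℚ) ^ s, k, n + s, ?_⟩, Subtype.ext ?_⟩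
  · rw [pow_add, ← h]
    field_simp
  · simp only [AddSubgroup.coe_nsmul, nsmul_eq_mul, Nat.cast_pow]
    field_simp

lemma exists_coprime_exponent_center {p n : ℕ} (hp : p.Prime)
    (σ : Gp p →* Matrix.unitaryGroup (Fin n) ℂ) :
    ∃ m : ℕ, m ≠ 0 ∧ p.Coprime m ∧ ∀ a : Zp p, σ (a, 0, 0) ^ m = 1 := by
  obtain ⟨s, m, hm, hn⟩ :=
    Nat.exists_eq_pow_mul_and_not_dvd n.factorial_ne_zero p hp.ne_one
  refine ⟨m, fun h => hm (h ▸ dvd_zero p), (Nat.Prime.coprime_iff_not_dvd hp).mpr hm, fun a => ?_⟩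
  obtain ⟨b, rfl⟩ := exists_pow_nsmul_eq hp.ne_zero s a
  rw [← Gp.central_pow, map_pow, ← pow_mul, ← hn]
  refine commutator_pow_factorial_eq_one (σ (0, 0, 1)) (σ (0, b, 0)) _ ?_ ?_ ?_
  · simp only [← map_mul, Gp.mul_def]
    simp
  · rw [commute_iff_eq]
    simp only [← map_mul, Gp.mul_def]
    simp
  · rw [commute_iff_eq]
    simp only [← map_mul, Gp.mul_def]
    simp

lemma trace_mul_central_pow {p n : ℕ} (σ : Gp p →* Matrix.unitaryGroup (Fin n) ℂ) (b : Zp p)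
    (i : ℕ) :
    ((σ (0, b, 0) : Matrix (Fin n) (Fin n) ℂ) * (σ (b, 0, 0)).1 ^ i).trace
      = (σ (0, b, 0)).1.trace := by
  have h : ((0, b, 0) : Gp p) * (b, 0, 0) ^ i = (0, 0, (i : ℤ)) * (0, b, 0) * (0, 0, -(i : ℤ)) := by
    simp [Gp.central_pow, Gp.mul_def]
  have h1 : ((0, 0, -(i : ℤ)) : Gp p) * (0, 0, (i : ℤ)) = 1 := by
    simp [Gp.one_def, Gp.mul_def]
  have h' := congrArg (fun g => (σ g : Matrix (Fin n) (Fin n) ℂ)) h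
  have h1' := congrArg (fun g => (σ g : Matrix (Fin n) (Fin n) ℂ)) h1
  simp only [map_mul, map_pow, map_one, Submonoid.coe_mul, SubmonoidClass.coe_pow,
    Submonoid.coe_one] at h' h1'
  rw [h', Matrix.trace_mul_comm, ← mul_assoc, h1', one_mul]

lemma hom_hsSq_lower_bound {p n : ℕ} (hp : p.Prime)
    (σ : Gp p →* Matrix.unitaryGroup (Fin n) ℂ) (ω : ℂ) :
    2 * n * ‖ω - 1‖ ^ 2 ≤ ‖ω - 1‖ ^ 2 * hsSq (1 - (σ (0, oneZp p, 0)).1)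
      + 2 * hsSq (ω • 1 - (σ (invZp p hp.ne_zero, 0, 0)).1) := by
  obtain ⟨m, hm0, hm, hexp⟩ := exists_coprime_exponent_center hp σ
  have star_mul : ∀ g, ((σ g).1)ᴴ * (σ g).1 = 1 := fun g =>
    Matrix.mem_unitaryGroup_iff'.mp (σ g).2
  have hYm : (σ (oneZp p, 0, 0)).1 ^ m = 1 := congrArg Subtype.val (hexp (oneZp p))
  obtain ⟨hP, hPP⟩ := powAverage_isProj hm0 (star_mul (oneZp p, 0, 0)) hYm
  refine hsSq_lower_bound (P := powAverage m (σ (oneZp p, 0, 0)).1) ω (star_mul _) hP hPP ?_ ?_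
  · have hpow : σ (invZp p hp.ne_zero, 0, 0) ^ p = σ (oneZp p, 0, 0) := by
      rw [← map_pow, Gp.central_pow]
      congr 2
      apply Subtype.ext
      have hp' : (p : ℚ) ≠ 0 := by exact_mod_cast hp.ne_zero
      simp [invZp, oneZp, hp']
    obtain ⟨r, hr⟩ := exists_pow_eq_self_of_coprime
      (hm.coprime_dvd_right (orderOf_dvd_of_pow_eq_one (hexp (invZp p hp.ne_zero))))
    rw [hpow] at hr
    rw [← hr, SubmonoidClass.coe_pow]
    clear hr
    induction r with
    | zero => simp
    | succ r ih => rw [pow_succ, mul_assoc, mul_powAverage hYm, ih]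
  · have hm' : (m : ℂ) ≠ 0 := by exact_mod_cast hm0
    rw [powAverage, mul_smul_comm, Finset.mul_sum, Matrix.trace_smul, Matrix.trace_sum,
      Finset.sum_congr rfl fun i _ => trace_mul_central_pow σ (oneZp p) i]
    simp [hm']

/-- `G_p` is not operator-norm-to-Hilbert–Schmidt stable: there is a
sequence of maps into unitary groups that is almost multiplicative in the operator norm
but cannot be HS-perturbed to a sequence of true homomorphisms. -/
theorem Gp_not_operator_HS_stable (p : ℕ) (hp : p.Prime) :
    ∃ (n : ℕ → ℕ), (∀ k, 0 < n k) ∧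
      ∃ π : ∀ k, Gp p → Matrix.unitaryGroup (Fin (n k)) ℂ,
        (∀ g h : Gp p,
          Tendsto (fun k =>
            opNorm (n k) ((π k (g * h) : Matrix (Fin (n k)) (Fin (n k)) ℂ) -
              (π k g : Matrix (Fin (n k)) (Fin (n k)) ℂ) *
                (π k h : Matrix (Fin (n k)) (Fin (n k)) ℂ))) atTop (nhds 0)) ∧
        ¬ ∃ σ : ∀ k, Gp p →* Matrix.unitaryGroup (Fin (n k)) ℂ,
            ∀ g : Gp p,
              Tendsto (fun k =>
                hsNorm (n k) ((π k g : Matrix (Fin (n k)) (Fin (n k)) ℂ) -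
                  (σ k g : Matrix (Fin (n k)) (Fin (n k)) ℂ))) atTop (nhds 0) := by
  have : ∀ k, NeZero (p ^ k) := fun k => ⟨pow_ne_zero k hp.ne_zero⟩
  refine ⟨fun k => p ^ k, fun k => pow_pos hp.pos k, fun k => finiteLevel p k, fun g h => ?_, ?_⟩
  · refine tendsto_const_nhds.congr' ?_
    filter_upwards [finiteLevel_mul p g h] with k hk
    simp [hk, opNorm]
  rintro ⟨σ, hσ⟩
  set ω : ℂ := Complex.exp (2 * Real.pi * Complex.I / p) with hω
  have hω1 : 0 < ‖ω - 1‖ ^ 2 := by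
    have h1 : ω ≠ 1 := (Complex.isPrimitiveRoot_exp p hp.ne_zero).ne_one hp.one_lt
    have : 0 < ‖ω - 1‖ := norm_pos_iff.mpr (sub_ne_zero.mpr h1)
    positivity
  have lim := (((hσ (0, oneZp p, 0)).pow 2).const_mul (‖ω - 1‖ ^ 2)).add
    (((hσ (invZp p hp.ne_zero, 0, 0)).pow 2).const_mul 2)
  have lower := ge_of_tendsto lim (b := 2 * ‖ω - 1‖ ^ 2) (by
    filter_upwards [eventually_ge_atTop 1] with k hk
    rw [hsNorm_sq, hsNorm_sq, finiteLevel_one, finiteLevel_inv p k hp.ne_zero hk, ← hω,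
      ← mul_div_assoc, ← mul_div_assoc, ← add_div, le_div_iff₀ (by exact_mod_cast pow_pos hp.pos k)]
    have := hom_hsSq_lower_bound hp (σ k) ω
    linarith)
  norm_num at lower
  linarith
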